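/- Let K_∞ be the maximal totally real subfield of the field obtained by adjoining to ℚ all q_i^j-th roots of unity for finitely many fixed primes q₁,…,q_k and all j ≥ 1. Then for every rational prime p, there is a uniform bound (independent of the number field M ⊆ K_∞) on the number of primes of M lying above p; i.e. sup over number fields M ⊆ K_∞ of the number of factors of p in M is finite. -/

import Mathlib

open NumberField

lemma val_bound (p q : ℕ) (hp : 1 < p) (hq : q.Prime) (hqp : ¬ q ∣ p) :
    ∃ c, ∀ f, f ≠ 0 → padicValNat q (p ^ f - 1) ≤ c + padicValNat q f := by
  have := Fact.mk hq
  have key : ∀ t f, t ≠ 0 → f ≠ 0 → padicValNat q (p ^ f - 1) ≤ padicValNat q (p ^ (t * f) - 1) := by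
    intro t f ht hf
    have h1 : p ^ (t * f) - 1 ≠ 0 :=
      Nat.sub_ne_zero_of_lt (Nat.one_lt_pow (mul_ne_zero ht hf) hp)
    refine (padicValNat_dvd_iff_le h1).mp (pow_padicValNat_dvd.trans ?_)
    exact Nat.pow_sub_one_dvd_pow_sub_one p (dvd_mul_left f t)
  rcases hq.eq_two_or_odd' with rfl | hodd
  · refine ⟨padicValNat 2 (p + 1) + padicValNat 2 (p - 1) + 1, fun f hf => ?_⟩
    have h1 := key 2 f (by norm_num) hf
    have h2 := padicValNat.pow_two_sub_one hp hqp (n := 2 * f) (by omega) (even_two_mul f)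
    rw [padicValNat.mul (by norm_num) hf, padicValNat_self] at h2
    omega
  · refine ⟨padicValNat q (p ^ (q - 1) - 1), fun f hf => ?_⟩
    have hq1 : q - 1 ≠ 0 := by have := hq.two_le; omega
    have h1 := key (q - 1) f hq1 hf
    have h3 : q ∣ p ^ (q - 1) - 1 := by
      have := Nat.ModEq.pow_totient (((Nat.Prime.coprime_iff_not_dvd hq).mpr hqp).symm)
      rw [Nat.totient_prime hq] at this
      exact (Nat.modEq_iff_dvd' (Nat.one_le_pow _ _ (by omega))).mp this.symm
    have h2 := padicValNat.pow_sub_pow hodd (x := p ^ (q - 1)) (y := 1)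
      (Nat.one_lt_pow hq1 hp) h3 (fun h => hqp (hq.dvd_of_dvd_pow h)) hf
    rw [one_pow, ← pow_mul] at h2
    omega

lemma ord_bound (p s : ℕ) (hp : 1 < p) (hs : p.Coprime s) (hs0 : s ≠ 0) :
    ∃ C, ∀ j f, f ≠ 0 → s ^ j ∣ p ^ f - 1 → s ^ j ≤ C * f := by
  have h : ∀ q : ℕ, ∃ c, q ∈ s.primeFactors →
      ∀ f, f ≠ 0 → padicValNat q (p ^ f - 1) ≤ c + padicValNat q f := by
    intro q
    by_cases hq : q ∈ s.primeFactors
    · have hq' := Nat.prime_of_mem_primeFactors hq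
      obtain ⟨c, hc⟩ := val_bound p q hp hq' (fun h => hq'.one_lt.ne'
        (Nat.Coprime.eq_one_of_dvd (hs.coprime_dvd_right (Nat.dvd_of_mem_primeFactors hq)).symm h))
      exact ⟨c, fun _ => hc⟩
    · exact ⟨0, fun h => absurd h hq⟩
  choose c hc using h
  have hC : (∏ q ∈ s.primeFactors, q ^ c q) ≠ 0 :=
    Finset.prod_ne_zero_iff.mpr fun q hq => pow_ne_zero _ (Nat.prime_of_mem_primeFactors hq).ne_zero
  refine ⟨∏ q ∈ s.primeFactors, q ^ c q, fun j f hf hd => ?_⟩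
  have h0 : (∏ q ∈ s.primeFactors, q ^ c q) * f ≠ 0 := mul_ne_zero hC hf
  have h1 : p ^ f - 1 ≠ 0 := Nat.sub_ne_zero_of_lt (Nat.one_lt_pow hf hp)
  refine Nat.le_of_dvd (Nat.pos_of_ne_zero h0) ?_
  rw [← Nat.factorization_prime_le_iff_dvd (pow_ne_zero _ hs0) h0]
  intro q hq
  have := Fact.mk hq
  rw [Nat.factorization_def _ hq, Nat.factorization_def _ hq]
  by_cases hqs : q ∈ s.primeFactors
  · have h2 : padicValNat q (s ^ j) ≤ padicValNat q (p ^ f - 1) :=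
      (padicValNat_dvd_iff_le h1).mp (pow_padicValNat_dvd.trans hd)
    have h3 := hc q hqs f hf
    rw [padicValNat.mul hC hf]
    have h4 : c q ≤ padicValNat q (∏ q ∈ s.primeFactors, q ^ c q) :=
      (padicValNat_dvd_iff_le hC).mp (Finset.dvd_prod_of_mem (fun q => q ^ c q) hqs)
    omega
  · have : ¬ q ∣ s ^ j := fun h => hqs (Nat.mem_primeFactors.mpr ⟨hq, hq.dvd_of_dvd_pow h, hs0⟩)
    rw [padicValNat.eq_zero_of_not_dvd this]
    exact Nat.zero_le _

lemma cyc_bound (p s : ℕ) (hp : p.Prime) (hs : p.Coprime s) (hs0 : s ≠ 0) :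
    ∃ C, ∀ (j : ℕ) (K : Type) [Field K] [NumberField K]
      [IsCyclotomicExtension {p ^ (j + 1) * s ^ j} ℚ K],
      (Ideal.primesOver (Ideal.span {(p : ℤ)}) (𝓞 K)).ncard ≤ C := by
  obtain ⟨C, hC⟩ := ord_bound p s hp.one_lt hs hs0
  refine ⟨C, fun j K _ _ _ => ?_⟩
  have := Fact.mk hp
  have : NeZero (p ^ (j + 1) * s ^ j) := ⟨mul_ne_zero (pow_ne_zero _ hp.ne_zero) (pow_ne_zero _ hs0)⟩
  have : NeZero (s ^ j) := ⟨pow_ne_zero _ hs0⟩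
  have hcop : p.Coprime (s ^ j) := hs.pow_right j
  have hm : ¬ p ∣ s ^ j := (Nat.Prime.coprime_iff_not_dvd hp).mp hcop
  have : IsGalois ℚ K := IsCyclotomicExtension.isGalois {p ^ (j + 1) * s ^ j} ℚ K
  have hI : Ideal.span {(p : ℤ)} ≠ ⊥ := by simp [hp.ne_zero]
  have hmax : (Ideal.span {(p : ℤ)}).IsMaximal :=
    Int.ideal_span_isMaximal_of_prime p
  have h_main := Ideal.ncard_primesOver_mul_ramificationIdxIn_mul_inertiaDegIn
    (Ideal.span {(p : ℤ)}) (𝓞 K) Gal(K/ℚ)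
  rw [IsCyclotomicExtension.Rat.inertiaDegIn_eq (p ^ (j + 1) * s ^ j) K rfl hm,
    IsCyclotomicExtension.Rat.ramificationIdxIn_eq (p ^ (j + 1) * s ^ j) K rfl hm,
    IsGalois.card_aut_eq_finrank, IsCyclotomicExtension.finrank K
      (Polynomial.cyclotomic.irreducible_rat (NeZero.pos (p ^ (j + 1) * s ^ j))),
    Nat.totient_mul (hcop.pow_left _), Nat.totient_prime_pow_succ hp] at h_main
  set f := orderOf (p : ZMod (s ^ j)) with hf
  have hfpos : 0 < f := by
    rw [hf, orderOf_pos_iff, isOfFinOrder_iff_isUnit]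
    exact (ZMod.isUnit_iff_coprime _ _).mpr hcop
  have hdvd : s ^ j ∣ p ^ f - 1 := by
    have h1 : (p : ZMod (s ^ j)) ^ f = 1 := pow_orderOf_eq_one _
    have h2 : ((p ^ f : ℕ) : ZMod (s ^ j)) = (1 : ℕ) := by push_cast; exact h1
    rw [ZMod.natCast_eq_natCast_iff] at h2
    exact (Nat.modEq_iff_dvd' (Nat.one_le_pow _ _ hp.pos)).mp h2.symm
  have h1 := hC j f hfpos.ne' hdvd
  have h2 := Nat.totient_le (s ^ j)
  have he : 0 < p ^ j * (p - 1) := Nat.mul_pos (pow_pos hp.pos _) (by have := hp.two_le; omega)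
  have h3 : (Ideal.primesOver (Ideal.span {(p : ℤ)}) (𝓞 K)).ncard * f = (s ^ j).totient := by
    apply Nat.eq_of_mul_eq_mul_left he
    rw [← h_main]; ring
  exact Nat.le_of_mul_le_mul_right (by omega) hfpos

lemma sub_bound (p : ℕ) (hp : p.Prime) (M K : IntermediateField ℚ ℂ) (h : M ≤ K)
    [NumberField M] [NumberField K] :
    Nat.card {Q : Ideal (𝓞 ↥M) // Q.IsMaximal ∧
        Q.comap (algebraMap ℤ (𝓞 ↥M)) = Ideal.span {((p : ℤ))}} ≤
    (Ideal.primesOver (Ideal.span {(p : ℤ)}) (𝓞 K)).ncard := by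
  let _ : Algebra M K := (IntermediateField.inclusion h).toRingHom.toAlgebra
  have := Fact.mk hp
  have hI : Ideal.span {(p : ℤ)} ≠ ⊥ := by simp [hp.ne_zero]
  have hmax : (Ideal.span {(p : ℤ)}).IsMaximal :=
    Int.ideal_span_isMaximal_of_prime p
  have hex : ∀ Q : {Q : Ideal (𝓞 ↥M) // Q.IsMaximal ∧
        Q.comap (algebraMap ℤ (𝓞 ↥M)) = Ideal.span {((p : ℤ))}},
      ∃ P : Ideal.primesOver (Ideal.span {(p : ℤ)}) (𝓞 K),
        P.1.comap (algebraMap (𝓞 M) (𝓞 K)) = Q.1 := by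
    rintro ⟨Q, hQ, hQ'⟩
    obtain ⟨P, hP, hPQ⟩ := Ideal.exists_ideal_over_maximal_of_isIntegral (S := 𝓞 K) Q (by
      rw [(RingHom.injective_iff_ker_eq_bot _).mp
        (FaithfulSMul.algebraMap_injective (𝓞 M) (𝓞 K))]
      exact bot_le)
    refine ⟨⟨P, hP.isPrime, ⟨?_⟩⟩, hPQ⟩
    rw [← hQ', ← hPQ, Ideal.under, Ideal.comap_comap]
    congr 1
  choose F hF using hex
  have : Finite (Ideal.primesOver (Ideal.span {(p : ℤ)}) (𝓞 K)) :=
    IsDedekindDomain.primesOver_finite (Ideal.span {(p : ℤ)}) (𝓞 K)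
  rw [← Nat.card_coe_set_eq]
  refine Nat.card_le_card_of_injective F fun a b hab => Subtype.ext ?_
  rw [← hF a, ← hF b, hab]

lemma exists_gen {F L : Type*} [Field F] [CharZero F] [Field L] [Algebra F L]
    (M : IntermediateField F L) (hfin : FiniteDimensional F M) :
    ∃ α ∈ M, ∀ E : IntermediateField F L, α ∈ E → M ≤ E := by
  obtain ⟨α, hα⟩ := Field.exists_primitive_element F M
  refine ⟨α, α.2, fun E hE x hx => ?_⟩
  have h1 : IntermediateField.adjoin F {α} ≤ E.comap M.val := by
    rw [IntermediateField.adjoin_simple_le_iff]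
    exact hE
  have h2 : (⟨x, hx⟩ : M) ∈ IntermediateField.adjoin F {α} := by
    rw [hα]; exact IntermediateField.mem_top
  exact h1 h2

theorem stmt13 (k : ℕ) (q : Fin k → ℕ) (hq : ∀ i, (q i).Prime)
    (Cyc Kinf : IntermediateField ℚ ℂ)
    (hCyc : Cyc = IntermediateField.adjoin ℚ
      {z : ℂ | ∃ (i : Fin k) (j : ℕ), 1 ≤ j ∧ z ^ (q i ^ j) = 1})
    (hKinf : ∀ z : ℂ, z ∈ Kinf ↔ z ∈ Cyc ∧ z.im = 0)
    (p : ℕ) (hp : p.Prime) :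
    ∃ B : ℕ, ∀ M : IntermediateField ℚ ℂ, M ≤ Kinf → FiniteDimensional ℚ ↥M →
      Nat.card {Q : Ideal (𝓞 ↥M) // Q.IsMaximal ∧
        Q.comap (algebraMap ℤ (𝓞 ↥M)) = Ideal.span {((p : ℤ))}} ≤ B := by
  classical
  set s : ℕ := ∏ i ∈ Finset.univ.filter (fun i => q i ≠ p), q i with hs_def
  have hs0 : s ≠ 0 := Finset.prod_ne_zero_iff.mpr fun i _ => (hq i).ne_zero
  have hs : p.Coprime s := Nat.Coprime.prod_right fun i hi =>
    (Nat.coprime_primes hp (hq i)).mpr (Finset.mem_filter.mp hi).2.symm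
  obtain ⟨C, hC⟩ := cyc_bound p s hp hs hs0
  refine ⟨C, fun M hM hfin => ?_⟩
  let n : ℕ → ℕ := fun j => p ^ (j + 1) * s ^ j
  have hn0 : ∀ j, n j ≠ 0 := fun j => mul_ne_zero (pow_ne_zero _ hp.ne_zero) (pow_ne_zero _ hs0)
  let ζ : ℕ → ℂ := fun j => Complex.exp (2 * Real.pi * Complex.I / (n j : ℕ))
  have hζ : ∀ j, IsPrimitiveRoot (ζ j) (n j) := fun j => Complex.isPrimitiveRoot_exp _ (hn0 j)
  let E : ℕ → IntermediateField ℚ ℂ := fun j => IntermediateField.adjoin ℚ {ζ j}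
  have hroot : ∀ j (z : ℂ), z ^ (n j) = 1 → z ∈ E j := by
    intro j z hz
    have : NeZero (n j) := ⟨hn0 j⟩
    obtain ⟨i, _, rfl⟩ := (hζ j).eq_pow_of_pow_eq_one hz
    exact pow_mem (IntermediateField.mem_adjoin_simple_self ℚ _) i
  have hdvd : ∀ a b, a ≤ b → n a ∣ n b := fun a b hab =>
    mul_dvd_mul (pow_dvd_pow _ (by omega)) (pow_dvd_pow _ hab)
  have hmono : ∀ a b, a ≤ b → E a ≤ E b := by
    intro a b hab
    rw [IntermediateField.adjoin_simple_le_iff]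
    apply hroot
    obtain ⟨d, hd⟩ := hdvd a b hab
    rw [hd, pow_mul, (hζ a).pow_eq_one, one_pow]
  have hcyc : ∀ z ∈ Cyc, ∃ j, z ∈ E j := by
    intro z hz
    rw [hCyc] at hz
    induction hz using IntermediateField.adjoin_induction with
    | mem x hx =>
      obtain ⟨i, j, _, hx⟩ := hx
      refine ⟨j, hroot j x ?_⟩
      have : q i ^ j ∣ n j := by
        by_cases hi : q i = p
        · rw [hi]; exact (pow_dvd_pow p (Nat.le_succ j)).trans (dvd_mul_right _ _)
        · exact (pow_dvd_pow_of_dvd (Finset.dvd_prod_of_mem q (by simp [hi])) j).trans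
            (dvd_mul_left _ _)
      obtain ⟨d, hd⟩ := this
      rw [hd, pow_mul, hx, one_pow]
    | algebraMap x => exact ⟨0, (E 0).algebraMap_mem x⟩
    | add x y _ _ hx hy =>
      obtain ⟨a, ha⟩ := hx
      obtain ⟨b, hb⟩ := hy
      exact ⟨max a b, add_mem (hmono _ _ (le_max_left a b) ha) (hmono _ _ (le_max_right a b) hb)⟩
    | inv x _ hx =>
      obtain ⟨a, ha⟩ := hx
      exact ⟨a, inv_mem ha⟩
    | mul x y _ _ hx hy =>
      obtain ⟨a, ha⟩ := hx
      obtain ⟨b, hb⟩ := hy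
      exact ⟨max a b, mul_mem (hmono _ _ (le_max_left a b) ha) (hmono _ _ (le_max_right a b) hb)⟩
  obtain ⟨α, hαM, hα⟩ := exists_gen M hfin
  obtain ⟨j, hj⟩ := hcyc α ((hKinf _).mp (hM hαM)).1
  have hME : M ≤ E j := hα _ hj
  have : NeZero (n j) := ⟨hn0 j⟩
  have hint : IsIntegral ℚ (ζ j) := ((hζ j).isIntegral (NeZero.pos _)).tower_top
  have : FiniteDimensional ℚ (E j) := IntermediateField.adjoin.finiteDimensional hint
  have : NumberField (E j) := ⟨⟩
  have : NumberField M := ⟨⟩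
  have : IsCyclotomicExtension {n j} ℚ (E j) := by
    change IsCyclotomicExtension {n j} ℚ (IntermediateField.adjoin ℚ {ζ j}).toSubalgebra
    rw [IntermediateField.adjoin_simple_toSubalgebra_of_isAlgebraic hint.isAlgebraic]
    exact (hζ j).adjoin_isCyclotomicExtension ℚ
  have : IsCyclotomicExtension {p ^ (j + 1) * s ^ j} ℚ (E j) := this
  exact (sub_bound p hp M (E j) hME).trans (hC j (E j))
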